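/- arXiv:2512.24967 — 5 statements merged into one kernel-verified Lean document; each statement's English description precedes it below -/
import Mathlib

section
/- Let A be a commutative ring and let R be a commutative Hopf algebra over A (with comultiplication Δ : R → R ⊗_A R, counit ε : R → A, and antipode) which is flat as an A-module. Let M be an A-module and let ρ : M → M ⊗_A R be an A-linear map which is a right comodule structure, i.e. (id_M ⊗ ε) ∘ ρ = id_M (under the canonical isomorphism M ⊗_A A ≅ M) and (ρ ⊗ id_R) ∘ ρ = (id_M ⊗ Δ) ∘ ρ as maps M → M ⊗_A R ⊗_A R. Then the unique R-module endomorphism α_ρ of M ⊗_A R satisfying α_ρ(m ⊗ 1) = ρ(m) for all m ∈ M is bijective. -/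
open TensorProduct

/-- `β : M ⊗[A] S → M ⊗[A] S` is `S`-linear for the `S`-module structure coming from
multiplication on the right tensor factor. -/
def IsLinearOverAux (A M S : Type*) [CommRing A] [AddCommGroup M] [Module A M]
    [CommRing S] [Algebra A S] (β : M ⊗[A] S →ₗ[A] M ⊗[A] S) : Prop :=
  ∀ (s : S) (x : M ⊗[A] S),
    β (LinearMap.lTensor M (LinearMap.mulRight A s) x) =
      LinearMap.lTensor M (LinearMap.mulRight A s) (β x)

namespace TensorProduct

variable {A R M : Type*} [CommRing A] [CommRing R] [AddCommGroup M] [Module A M]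

section Algebra

variable [Algebra A R]

/-- The extension of `f : M → M ⊗[A] R` to an `R`-linear endomorphism of `M ⊗[A] R`,
given by `m ⊗ r ↦ f m * r`. -/
def extendRight (f : M →ₗ[A] M ⊗[A] R) : M ⊗[A] R →ₗ[A] M ⊗[A] R :=
  LinearMap.lTensor M (LinearMap.mul' A R) ∘ₗ (TensorProduct.assoc A M R R).toLinearMap ∘ₗ
    LinearMap.rTensor R f

theorem extendRight_tmul (f : M →ₗ[A] M ⊗[A] R) (m : M) (r : R) :
    extendRight f (m ⊗ₜ r) = LinearMap.lTensor M (LinearMap.mulRight A r) (f m) := by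
  simp only [extendRight, LinearMap.comp_apply, LinearMap.rTensor_tmul, LinearEquiv.coe_coe]
  induction f m with
  | zero => simp
  | tmul n s => simp
  | add x y hx hy => simp only [add_tmul, map_add, hx, hy]

theorem isLinearOverAux_extendRight (f : M →ₗ[A] M ⊗[A] R) :
    IsLinearOverAux A M R (extendRight f) := by
  intro s x
  induction x with
  | zero => simp
  | tmul m r =>
    rw [LinearMap.lTensor_tmul, extendRight_tmul, extendRight_tmul, LinearMap.mulRight_apply,
      LinearMap.mulRight_mul, LinearMap.lTensor_comp, LinearMap.comp_apply]
  | add x y hx hy => simp only [map_add, hx, hy]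

theorem eq_extendRight {α : M ⊗[A] R →ₗ[A] M ⊗[A] R} (hα : IsLinearOverAux A M R α)
    {f : M →ₗ[A] M ⊗[A] R} (hf : ∀ m, α (m ⊗ₜ 1) = f m) : α = extendRight f := by
  ext m r
  have h := hα r (m ⊗ₜ 1)
  rw [LinearMap.lTensor_tmul, LinearMap.mulRight_apply, one_mul, hf] at h
  simpa [extendRight_tmul] using h

theorem extendRight_comp_eq_id {f g : M →ₗ[A] M ⊗[A] R}
    (h : ∀ m, extendRight f (g m) = m ⊗ₜ 1) :
    extendRight f ∘ₗ extendRight g = LinearMap.id := by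
  ext m r
  simp [extendRight_tmul, isLinearOverAux_extendRight f r, h]

theorem extendRight_lTensor_comp (ρ : M →ₗ[A] M ⊗[A] R) (f g : R →ₗ[A] R) :
    extendRight (LinearMap.lTensor M f ∘ₗ ρ) ∘ₗ LinearMap.lTensor M g =
      LinearMap.lTensor M (LinearMap.mul' A R ∘ₗ TensorProduct.map f g) ∘ₗ
        (TensorProduct.assoc A M R R).toLinearMap ∘ₗ LinearMap.rTensor R ρ := by
  ext m r
  simp only [AlgebraTensorModule.curry_apply, curry_apply, LinearMap.coe_restrictScalars,
    LinearMap.comp_apply, LinearMap.lTensor_tmul, LinearMap.rTensor_tmul, extendRight_tmul,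
    LinearEquiv.coe_coe]
  induction ρ m with
  | zero => simp
  | tmul n s => simp
  | add x y hx hy => simp only [add_tmul, map_add, hx, hy]

end Algebra

theorem extendRight_convolution_eq_tmul_one [Bialgebra A R] {ρ : M →ₗ[A] M ⊗[A] R}
    (h_counit : (TensorProduct.rid A M).toLinearMap ∘ₗ
        LinearMap.lTensor M (Coalgebra.counit : R →ₗ[A] A) ∘ₗ ρ = LinearMap.id)
    (h_coassoc : LinearMap.lTensor M (Coalgebra.comul : R →ₗ[A] R ⊗[A] R) ∘ₗ ρ =
        (TensorProduct.assoc A M R R).toLinearMap ∘ₗ LinearMap.rTensor R ρ ∘ₗ ρ)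
    {f g : R →ₗ[A] R}
    (hfg : LinearMap.mul' A R ∘ₗ TensorProduct.map f g ∘ₗ Coalgebra.comul =
      Algebra.linearMap A R ∘ₗ Coalgebra.counit) (m : M) :
    extendRight (LinearMap.lTensor M f ∘ₗ ρ) (LinearMap.lTensor M g (ρ m)) = m ⊗ₜ 1 := by
  have h₁ := LinearMap.congr_fun (extendRight_lTensor_comp ρ f g) (ρ m)
  have h₂ := LinearMap.congr_fun h_coassoc m
  have h₃ : LinearMap.lTensor M (Coalgebra.counit : R →ₗ[A] A) (ρ m) = m ⊗ₜ 1 :=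
    (TensorProduct.rid A M).injective (by simpa using LinearMap.congr_fun h_counit m)
  simp only [LinearMap.comp_apply] at h₁ h₂
  rw [h₁, ← h₂, ← LinearMap.comp_apply, ← LinearMap.lTensor_comp, LinearMap.comp_assoc, hfg,
    LinearMap.lTensor_comp, LinearMap.comp_apply, h₃]
  simp

end TensorProduct

/-- Let `A` be a commutative ring and `R` a commutative Hopf algebra over `A` which is flat
as an `A`-module.  Let `M` be an `A`-module and `ρ : M → M ⊗[A] R` a right comodule
structure (counit and coassociativity axioms).  Then the unique `R`-module endomorphism
`α` of `M ⊗[A] R` with `α (m ⊗ 1) = ρ m` is bijective. -/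
theorem statement0 (A R M : Type*) [CommRing A] [CommRing R] [HopfAlgebra A R]
    [Module.Flat A R] [AddCommGroup M] [Module A M]
    (ρ : M →ₗ[A] M ⊗[A] R)
    (h_counit : (TensorProduct.rid A M).toLinearMap ∘ₗ
        LinearMap.lTensor M (Coalgebra.counit : R →ₗ[A] A) ∘ₗ ρ = LinearMap.id)
    (h_coassoc : LinearMap.lTensor M (Coalgebra.comul : R →ₗ[A] R ⊗[A] R) ∘ₗ ρ =
        (TensorProduct.assoc A M R R).toLinearMap ∘ₗ LinearMap.rTensor R ρ ∘ₗ ρ)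
    (α : M ⊗[A] R →ₗ[A] M ⊗[A] R)
    (hα_lin : IsLinearOverAux A M R α)
    (hα_one : ∀ m : M, α (m ⊗ₜ[A] (1 : R)) = ρ m) :
    Function.Bijective α := by
  obtain rfl := TensorProduct.eq_extendRight hα_lin hα_one
  have h₁ : TensorProduct.extendRight ρ ∘ₗ TensorProduct.extendRight
      (LinearMap.lTensor M (HopfAlgebra.antipode A) ∘ₗ ρ) = LinearMap.id :=
    TensorProduct.extendRight_comp_eq_id fun m => by
      simpa using TensorProduct.extendRight_convolution_eq_tmul_one h_counit h_coassoc
        (f := LinearMap.id) (HopfAlgebra.mul_antipode_lTensor_comul (R := A) (A := R)) m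
  have h₂ : TensorProduct.extendRight (LinearMap.lTensor M (HopfAlgebra.antipode A) ∘ₗ ρ) ∘ₗ
      TensorProduct.extendRight ρ = LinearMap.id :=
    TensorProduct.extendRight_comp_eq_id fun m => by
      simpa using TensorProduct.extendRight_convolution_eq_tmul_one h_counit h_coassoc
        (g := LinearMap.id) (HopfAlgebra.mul_antipode_rTensor_comul (R := A) (A := R)) m
  exact Function.bijective_iff_has_inverse.mpr
    ⟨TensorProduct.extendRight (LinearMap.lTensor M (HopfAlgebra.antipode A) ∘ₗ ρ),
      LinearMap.congr_fun h₂, LinearMap.congr_fun h₁⟩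
end

section
/- Let R be a commutative ring equipped with a nonarchimedean ring seminorm ‖·‖, and let r > 0 be a real number. Let C_r(R) be the set of sequences a : ℕ → R such that there exists a real r' > r with ‖aₙ‖·r'ⁿ → 0 as n → ∞. For sequences a, b define the divided-power convolution (a ⋆ b)ₙ = Σ_{k=0}^{n} C(n,k)·aₖ·b_{n−k}, where the binomial coefficient C(n,k) acts by repeated addition. Then C_r(R) contains the unit sequence (1, 0, 0, …) and is closed under ⋆; equivalently, the set of divided power series Σₙ aₙ Tⁿ/n! with coefficient sequence in C_r(R) is closed under multiplication of power series. -/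
open Filter

/-- The set of coefficient sequences of overconvergent radius-`r` (divided power) series
over a ring `R` with a seminorm `ν`: sequences `a` such that `ν (a n) * r'ⁿ → 0` for some
`r' > r`. -/
def Cr (R : Type*) [CommRing R] (ν : R → ℝ) (r : ℝ) : Set (ℕ → R) :=
  {a | ∃ r' : ℝ, r < r' ∧ Tendsto (fun n : ℕ => ν (a n) * r' ^ n) atTop (nhds 0)}

theorem mem_Cr_iff_exists_bound {R : Type*} [CommRing R] {ν : R → ℝ} (hν_nonneg : ∀ x, 0 ≤ ν x)
    {r : ℝ} (hr : 0 < r) {a : ℕ → R} :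
    a ∈ Cr R ν r ↔ ∃ s : ℝ, r < s ∧ ∃ A : ℝ, ∀ n, ν (a n) * s ^ n ≤ A := by
  constructor
  · rintro ⟨s, hs, h⟩
    obtain ⟨A, hA⟩ := h.bddAbove_range
    exact ⟨s, hs, A, fun n => hA ⟨n, rfl⟩⟩
  · rintro ⟨s, hs, A, hA⟩
    obtain ⟨t, hrt, hts⟩ := exists_between hs
    have ht : 0 < t := hr.trans hrt
    have hs0 : 0 < s := ht.trans hts
    refine ⟨t, hrt, squeeze_zero (g := fun n => A * (t / s) ^ n)
      (fun n => mul_nonneg (hν_nonneg _) (by positivity)) (fun n => ?_) ?_⟩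
    · calc ν (a n) * t ^ n = ν (a n) * s ^ n * (t / s) ^ n := by
            rw [div_pow]; field_simp
        _ ≤ A * (t / s) ^ n := by gcongr; exact hA n
    · simpa using (tendsto_pow_atTop_nhds_zero_of_lt_one (by positivity)
        ((div_lt_one hs0).2 hts)).const_mul A

theorem apply_nsmul_le_of_nonarchimedean {R : Type*} [AddCommMonoid R] {ν : R → ℝ}
    (hν_nonneg : ∀ x, 0 ≤ ν x) (hν_zero : ν 0 = 0)
    (hν_add : ∀ x y, ν (x + y) ≤ max (ν x) (ν y)) (m : ℕ) (x : R) : ν (m • x) ≤ ν x := by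
  induction m with
  | zero => simpa [hν_zero] using hν_nonneg x
  | succ m ih => rw [succ_nsmul]; exact (hν_add _ _).trans (max_le ih le_rfl)

/-- Let `R` be a commutative ring with a nonarchimedean ring seminorm `ν` and let `r > 0`.
The set `C_r(R)` of coefficient sequences with `ν (a n) * r'ⁿ → 0` for some `r' > r`
contains the unit sequence `(1,0,0,…)` and is closed under the divided power convolution
`(a ⋆ b)ₙ = ∑ₖ C(n,k) aₖ b_{n-k}`, i.e. under multiplication of the divided power series
`∑ aₙ Tⁿ/n!`. -/
theorem statement5 (R : Type*) [CommRing R] (ν : R → ℝ)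
    (hν_nonneg : ∀ x, 0 ≤ ν x) (hν_zero : ν 0 = 0)
    (hν_add : ∀ x y, ν (x + y) ≤ max (ν x) (ν y))
    (hν_mul : ∀ x y, ν (x * y) ≤ ν x * ν y)
    (r : ℝ) (hr : 0 < r) :
    ((fun n : ℕ => if n = 0 then (1 : R) else 0) ∈ Cr R ν r) ∧
      (∀ a ∈ Cr R ν r, ∀ b ∈ Cr R ν r,
        (fun n : ℕ => ∑ k ∈ Finset.range (n + 1), (n.choose k) • (a k * b (n - k))) ∈
          Cr R ν r) := by
  simp only [mem_Cr_iff_exists_bound hν_nonneg hr]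
  refine ⟨⟨r + 1, by linarith, ν 1, fun n => ?_⟩, ?_⟩
  · by_cases hn : n = 0
    · simp [hn]
    · simpa [hn, hν_zero] using hν_nonneg 1
  rintro a ⟨s₁, hs₁, A, hA⟩ b ⟨s₂, hs₂, B, hB⟩
  have hs : r < min s₁ s₂ := lt_min hs₁ hs₂
  have hs0 : 0 < min s₁ s₂ := hr.trans hs
  refine ⟨min s₁ s₂, hs, A * B, fun n => ?_⟩
  have hA' (k : ℕ) : ν (a k) * min s₁ s₂ ^ k ≤ A :=
    (mul_le_mul_of_nonneg_left (pow_le_pow_left₀ hs0.le (min_le_left _ _) k)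
      (hν_nonneg _)).trans (hA k)
  have hB' (k : ℕ) : ν (b k) * min s₁ s₂ ^ k ≤ B :=
    (mul_le_mul_of_nonneg_left (pow_le_pow_left₀ hs0.le (min_le_right _ _) k)
      (hν_nonneg _)).trans (hB k)
  have hA0 : 0 ≤ A := (mul_nonneg (hν_nonneg (a 0)) (by positivity)).trans (hA' 0)
  have hB0 : 0 ≤ B := (mul_nonneg (hν_nonneg (b 0)) (by positivity)).trans (hB' 0)
  refine Finset.sum_induction _ (fun x => ν x * min s₁ s₂ ^ n ≤ A * B) (fun x y hx hy => ?_)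
    (by simpa [hν_zero] using mul_nonneg hA0 hB0) (fun k hk => ?_)
  · refine (mul_le_mul_of_nonneg_right (hν_add x y) (by positivity)).trans ?_
    rw [max_mul_of_nonneg _ _ (by positivity)]
    exact max_le hx hy
  · have hkn : k + (n - k) = n := by have := Finset.mem_range.1 hk; omega
    calc ν (n.choose k • (a k * b (n - k))) * min s₁ s₂ ^ n
        ≤ ν (a k) * ν (b (n - k)) * min s₁ s₂ ^ n := by
          gcongr
          exact (apply_nsmul_le_of_nonarchimedean hν_nonneg hν_zero hν_add _ _).trans (hν_mul _ _)
      _ = ν (a k) * min s₁ s₂ ^ k * (ν (b (n - k)) * min s₁ s₂ ^ (n - k)) := by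
          rw [mul_mul_mul_comm, ← pow_add, hkn]
      _ ≤ A * B := mul_le_mul (hA' k) (hB' _)
          (mul_nonneg (hν_nonneg _) (by positivity)) hA0
end

section
/- Let R be a commutative ring equipped with a nonarchimedean ring seminorm ‖·‖, let r > 0, and let C_r(R) be the set of sequences a : ℕ → R such that there exists r' > r with ‖aₙ‖·r'ⁿ → 0 as n → ∞. The shift map ∂ : (aₙ)ₙ ↦ (a_{n+1})ₙ, which corresponds to the formal derivative Σₙ aₙTⁿ/n! ↦ Σₙ a_{n+1}Tⁿ/n! on divided power series, maps C_r(R) onto C_r(R), and its kernel consists exactly of the sequences supported in degree 0. In other words, 0 → R → C_r(R) →^{∂} C_r(R) → 0 is a short exact sequence of R-modules. -/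
open Filter

/-- For `r > 0`, a sequence is overconvergent of radius `r` if and only if its shift is. -/
lemma shift_mem_Cr_iff {R : Type*} [CommRing R] {ν : R → ℝ} {r : ℝ} (hr : 0 < r) {a : ℕ → R} :
    (fun n : ℕ => a (n + 1)) ∈ Cr R ν r ↔ a ∈ Cr R ν r := by
  refine exists_congr fun r' => and_congr_right fun hr' => ?_
  have hr0 : r' ≠ 0 := (hr.trans hr').ne'
  rw [← tendsto_add_atTop_iff_nat (f := fun n : ℕ => ν (a n) * r' ^ n) 1]
  simp only [pow_succ, ← mul_assoc]
  constructor
  · intro h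
    simpa using h.mul_const r'
  · intro h
    simpa [hr0] using h.mul_const r'⁻¹

lemma zero_mem_Cr {R : Type*} [CommRing R] {ν : R → ℝ} (hν_zero : ν 0 = 0) (r : ℝ) :
    (fun _ : ℕ => (0 : R)) ∈ Cr R ν r :=
  ⟨r + 1, lt_add_one r, by simp [hν_zero]⟩

/-- Let `R` be a commutative ring with a nonarchimedean ring seminorm `ν` and let `r > 0`.
The shift map `∂ : (aₙ)ₙ ↦ (a_{n+1})ₙ` (the formal derivative on divided power series
`∑ aₙTⁿ/n!`) maps `C_r(R)` onto `C_r(R)`, and its kernel consists exactly of the sequences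
supported in degree `0` (which all lie in `C_r(R)`): the Poincaré short exact sequence
`0 → R → C_r(R) → C_r(R) → 0`. -/
theorem statement6 (R : Type*) [CommRing R] (ν : R → ℝ)
    (hν_nonneg : ∀ x, 0 ≤ ν x) (hν_zero : ν 0 = 0)
    (hν_add : ∀ x y, ν (x + y) ≤ max (ν x) (ν y))
    (hν_mul : ∀ x y, ν (x * y) ≤ ν x * ν y)
    (r : ℝ) (hr : 0 < r) :
    (∀ x : R, (fun n : ℕ => if n = 0 then x else 0) ∈ Cr R ν r) ∧
      (∀ a ∈ Cr R ν r, (fun n : ℕ => a (n + 1)) ∈ Cr R ν r) ∧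
      (∀ b ∈ Cr R ν r, ∃ a ∈ Cr R ν r, (fun n : ℕ => a (n + 1)) = b) ∧
      (∀ a ∈ Cr R ν r,
        ((fun n : ℕ => a (n + 1)) = (fun _ : ℕ => (0 : R)) ↔
          ∃ x : R, a = fun n : ℕ => if n = 0 then x else 0)) := by
  refine ⟨fun x => ?_, fun a ha => (shift_mem_Cr_iff hr).2 ha, fun b hb => ?_,
    fun a _ => ⟨fun h => ?_, ?_⟩⟩
  · rw [← shift_mem_Cr_iff hr]
    simpa using zero_mem_Cr hν_zero r
  · let a : ℕ → R := fun n => Nat.casesOn n 0 b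
    exact ⟨a, (shift_mem_Cr_iff (a := a) hr).1 hb, rfl⟩
  · refine ⟨a 0, funext fun n => ?_⟩
    cases n with
    | zero => simp
    | succ n => simpa using congrFun h n
  · rintro ⟨x, rfl⟩
    simp
end

section
/- Let p be a prime, let ‖·‖_p be the p-adic absolute value on ℚ_p normalized by ‖p‖_p = p⁻¹, and let r > 0 be a real number. For every sequence a : ℕ → ℚ_p the following are equivalent: (1) there exists r' > r such that ‖aₙ‖_p · r'ⁿ → 0 as n → ∞; (2) there exists s > r·p^{−1/(p−1)} such that ‖aₙ/n!‖_p · sⁿ → 0 as n → ∞. Equivalently, inside ℚ_p[[T]] the overconvergent divided power disc algebra {Σₙ aₙ Tⁿ/n! : ∃ r' > r, ‖aₙ‖_p r'ⁿ → 0} coincides with the overconvergent Tate-type disc algebra {Σₙ bₙ Tⁿ : ∃ s > r·p^{−1/(p−1)}, ‖bₙ‖_p sⁿ → 0}; that is, 𝔻^{♯,≤r}_{ℚ_p} = 𝔻^{≤ r·p^{−1/(p−1)}}_{ℚ_p}. -/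
open Filter

/-- The radius of convergence `p^{-1/(p-1)}` of the `p`-adic exponential. -/
noncomputable def padicExpRadius (p : ℕ) : ℝ := (p : ℝ) ^ (-(1 : ℝ) / ((p : ℝ) - 1))

section PadicExpRadius

variable (p : ℕ) [hp : Fact p.Prime]

lemma padicExpRadius_pos : 0 < padicExpRadius p :=
  Real.rpow_pos_of_pos (Nat.cast_pos.mpr hp.out.pos) _

lemma padicExpRadius_pow_sub_one : padicExpRadius p ^ (p - 1) = (p : ℝ)⁻¹ := by
  have h : (1 : ℝ) < p := Nat.one_lt_cast.mpr hp.out.one_lt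
  have h' : (p : ℝ) - 1 ≠ 0 := by linarith
  rw [padicExpRadius, ← Real.rpow_natCast, ← Real.rpow_mul (by positivity),
    Nat.cast_sub hp.out.one_le, Nat.cast_one, div_mul_cancel₀ _ h', Real.rpow_neg_one]

lemma padicExpRadius_le_one : padicExpRadius p ≤ 1 := by
  have h : (1 : ℝ) < p := Nat.one_lt_cast.mpr hp.out.one_lt
  exact Real.rpow_le_one_of_one_le_of_nonpos h.le
    (div_nonpos_of_nonpos_of_nonneg (by norm_num) (by linarith))

lemma Padic.norm_factorial_mul_padicExpRadius_pow (n : ℕ) :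
    ‖(n.factorial : ℚ_[p])‖ * padicExpRadius p ^ (p.digits n).sum = padicExpRadius p ^ n := by
  have hv := sub_one_mul_padicValNat_factorial (p := p) n
  have hs := Nat.digit_sum_le p n
  rw [Padic.norm_eq_zpow_neg_valuation (Nat.cast_ne_zero.mpr n.factorial_ne_zero),
    Padic.valuation_natCast, zpow_neg, zpow_natCast, ← inv_pow, ← padicExpRadius_pow_sub_one,
    ← pow_mul, hv, ← pow_add, Nat.sub_add_cancel hs]

lemma Padic.padicExpRadius_pow_le_norm_factorial (n : ℕ) :
    padicExpRadius p ^ n ≤ ‖(n.factorial : ℚ_[p])‖ := by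
  rw [← Padic.norm_factorial_mul_padicExpRadius_pow]
  exact mul_le_of_le_one_right (norm_nonneg _)
    (pow_le_one₀ (padicExpRadius_pos p).le (padicExpRadius_le_one p))

lemma Nat.sum_digits_le_mul_log {b n : ℕ} (hb : 1 < b) (hn : n ≠ 0) :
    (b.digits n).sum ≤ (b - 1) * (Nat.log b n + 1) := by
  have h := List.sum_le_card_nsmul (b.digits n) (b - 1)
    fun d hd => Nat.le_sub_one_of_lt (Nat.digits_lt_base hb hd)
  rwa [Nat.length_digits b n hb hn, smul_eq_mul, mul_comm] at h

lemma Padic.norm_factorial_le {n : ℕ} (hn : n ≠ 0) :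
    ‖(n.factorial : ℚ_[p])‖ ≤ padicExpRadius p ^ n * (p * n) := by
  have hp0 : (0 : ℝ) < p := Nat.cast_pos.mpr hp.out.pos
  have hlog : ((p : ℝ) ^ (Nat.log p n + 1)) ≤ p * n := by
    rw [pow_succ']
    gcongr
    exact_mod_cast Nat.pow_log_le_self p hn
  have hdigits : ((p : ℝ) ^ (Nat.log p n + 1))⁻¹ ≤ padicExpRadius p ^ (p.digits n).sum := by
    rw [← inv_pow, ← padicExpRadius_pow_sub_one, ← pow_mul]
    exact pow_le_pow_of_le_one (padicExpRadius_pos p).le (padicExpRadius_le_one p)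
      (Nat.sum_digits_le_mul_log hp.out.one_lt hn)
  have hone : 1 ≤ padicExpRadius p ^ (p.digits n).sum * (p * n) :=
    calc (1 : ℝ) = ((p : ℝ) ^ (Nat.log p n + 1))⁻¹ * (p : ℝ) ^ (Nat.log p n + 1) :=
          (inv_mul_cancel₀ (by positivity)).symm
      _ ≤ _ := mul_le_mul hdigits hlog (by positivity) (pow_pos (padicExpRadius_pos p) _).le
  rw [← Padic.norm_factorial_mul_padicExpRadius_pow, mul_assoc]
  exact le_mul_of_one_le_right (norm_nonneg _) hone

end PadicExpRadius

/-- Over `ℚ_p` (with `‖p‖ = p⁻¹`), the overconvergent divided power disc of radius `r`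
coincides with the overconvergent disc of radius `r·p^{-1/(p-1)}`: a sequence of
coefficients `a` is overconvergent of radius `r` iff the sequence `a n / n!` is
overconvergent of radius `r·p^{-1/(p-1)}`. -/
theorem statement7 (p : ℕ) [Fact p.Prime] (r : ℝ) (hr : 0 < r) (a : ℕ → ℚ_[p]) :
    (∃ r' : ℝ, r < r' ∧
        Tendsto (fun n : ℕ => ‖a n‖ * r' ^ n) atTop (nhds 0)) ↔
      (∃ s : ℝ, r * (p : ℝ) ^ (-(1 : ℝ) / ((p : ℝ) - 1)) < s ∧
        Tendsto (fun n : ℕ => ‖a n / (n.factorial : ℚ_[p])‖ * s ^ n) atTop (nhds 0)) := by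
  change _ ↔ ∃ s : ℝ, r * padicExpRadius p < s ∧ _
  have hρ := padicExpRadius_pos p
  have hfac (n : ℕ) : 0 < ‖(n.factorial : ℚ_[p])‖ :=
    norm_pos_iff.mpr (Nat.cast_ne_zero.mpr n.factorial_ne_zero)
  constructor
  · rintro ⟨r', hr', h⟩
    have hr'0 : 0 < r' := hr.trans hr'
    refine ⟨r' * padicExpRadius p, by gcongr, squeeze_zero (fun n => by positivity) (fun n => ?_) h⟩
    rw [norm_div, div_mul_eq_mul_div, div_le_iff₀ (hfac n), mul_pow, ← mul_assoc]
    gcongr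
    exact Padic.padicExpRadius_pow_le_norm_factorial p n
  · rintro ⟨s, hs, h⟩
    obtain ⟨r', hr', hlt⟩ := exists_between ((lt_div_iff₀ hρ).mpr hs)
    have hr'0 : 0 < r' := hr.trans hr'
    have hs0 : 0 < s := (mul_pos hr hρ).trans hs
    have hq : r' * padicExpRadius p / s < 1 := by
      rwa [div_lt_one hs0, ← lt_div_iff₀ hρ]
    have hlim := h.mul ((tendsto_self_mul_const_pow_of_lt_one (by positivity) hq).const_mul (p : ℝ))
    rw [mul_zero, mul_zero] at hlim
    refine ⟨r', hr', squeeze_zero' (.of_forall fun n => by positivity) ?_ hlim⟩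
    filter_upwards [eventually_ne_atTop 0] with n hn
    calc ‖a n‖ * r' ^ n
        = ‖a n / (n.factorial : ℚ_[p])‖ * ‖(n.factorial : ℚ_[p])‖ * r' ^ n := by
          rw [norm_div, div_mul_cancel₀ _ (hfac n).ne']
      _ ≤ ‖a n / (n.factorial : ℚ_[p])‖ * (padicExpRadius p ^ n * (p * n)) * r' ^ n := by
          gcongr
          exact Padic.norm_factorial_le p hn
      _ = _ := by
          rw [div_pow, mul_pow]
          field_simp
end

section
/- Fix a prime p and a real number s > 0. Let A be the ℚ_p-vector space of sequences a : ℕ → ℚ_p such that ‖aₙ‖_p·tⁿ → 0 for every real t with 0 < t < s (the coefficient sequences of rigid analytic functions on the open disc of radius s), endowed with the topology defined by the seminorms ‖a‖_t = supₙ ‖aₙ‖_p·tⁿ for 0 < t < s. Then: (1) a ℚ_p-linear map λ : A → ℚ_p is continuous if and only if there exist 0 < t < s and C ≥ 0 with ‖λ(a)‖_p ≤ C·‖a‖_t for all a ∈ A; (2) the map sending a continuous ℚ_p-linear functional λ to the sequence (λ(eₙ))ₙ, where eₙ is the n-th standard basis sequence, is a ℚ_p-linear bijection from the continuous dual of A onto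 the space of sequences b : ℕ → ℚ_p for which there exists u > 1/s with ‖bₙ‖_p·uⁿ → 0; moreover for every a ∈ A the series Σₙ aₙ·bₙ converges in ℚ_p and equals λ(a). -/
open Filter

/-- The space of coefficient sequences of rigid analytic functions on the open disc of
radius `s` over `ℚ_p`: sequences `a` with `‖a n‖ tⁿ → 0` for every `0 < t < s`. -/
noncomputable def discSpace (p : ℕ) [Fact p.Prime] (s : ℝ) :
    Submodule ℚ_[p] (ℕ → ℚ_[p]) where
  carrier := {a | ∀ t : ℝ, 0 < t → t < s →
    Tendsto (fun n : ℕ => ‖a n‖ * t ^ n) atTop (nhds 0)}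
  zero_mem' := by
    intro t ht hts
    simp only [Pi.zero_apply, norm_zero, zero_mul]
    exact tendsto_const_nhds
  add_mem' := by
    intro a b ha hb t ht hts
    have hg : Tendsto (fun n : ℕ => ‖a n‖ * t ^ n + ‖b n‖ * t ^ n) atTop (nhds 0) := by
      simpa using (ha t ht hts).add (hb t ht hts)
    refine squeeze_zero (fun n => by positivity) (fun n => ?_) hg
    have h1 : ‖(a + b) n‖ ≤ ‖a n‖ + ‖b n‖ := by
      simpa using norm_add_le (a n) (b n)
    calc ‖(a + b) n‖ * t ^ n ≤ (‖a n‖ + ‖b n‖) * t ^ n :=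
          mul_le_mul_of_nonneg_right h1 (by positivity)
      _ = ‖a n‖ * t ^ n + ‖b n‖ * t ^ n := by ring
  smul_mem' := by
    intro c a ha t ht hts
    have h := (ha t ht hts).const_mul ‖c‖
    rw [mul_zero] at h
    refine h.congr fun n => ?_
    simp [norm_smul, mul_assoc]

/-- The seminorm `‖a‖_t = supₙ ‖a n‖ tⁿ`. -/
noncomputable def supNorm (p : ℕ) [Fact p.Prime] (t : ℝ) (a : ℕ → ℚ_[p]) : ℝ :=
  ⨆ n : ℕ, ‖a n‖ * t ^ n

/-- The Fréchet topology on the space of functions on the open disc of radius `s`, defined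
by the family of seminorms `‖·‖_t` for `0 < t < s`: the seminorm balls form a subbasis
(hence, the family being directed, a basis). -/
noncomputable def discTopology (p : ℕ) [Fact p.Prime] (s : ℝ) :
    TopologicalSpace ↥(discSpace p s) :=
  TopologicalSpace.generateFrom
    {U | ∃ (y : ↥(discSpace p s)) (t ε : ℝ), 0 < t ∧ t < s ∧ 0 < ε ∧
      U = {x : ↥(discSpace p s) |
        supNorm p t ((x : ℕ → ℚ_[p]) - (y : ℕ → ℚ_[p])) < ε}}

/-- The `n`-th standard basis sequence `eₙ`, as an element of the disc space. -/
noncomputable def stdSeq (p : ℕ) [Fact p.Prime] (s : ℝ) (n : ℕ) : ↥(discSpace p s) :=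
  ⟨fun k => if k = n then 1 else 0, by
    intro t ht hts
    refine Filter.Tendsto.congr' ?_
      (tendsto_const_nhds : Tendsto (fun _ : ℕ => (0 : ℝ)) atTop (nhds 0))
    filter_upwards [eventually_gt_atTop n] with k hk
    simp [hk.ne']⟩

/-- The sequences `‖a n‖ tⁿ` attached to an element of the disc space are bounded. -/
theorem discSpace_bddAbove {p : ℕ} [Fact p.Prime] {s t : ℝ} (ht : 0 < t) (hts : t < s)
    (a : discSpace p s) :
    BddAbove (Set.range fun n : ℕ => ‖(a : ℕ → ℚ_[p]) n‖ * t ^ n) :=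
  (a.2 t ht hts).bddAbove_range

theorem le_supNorm {p : ℕ} [Fact p.Prime] {s t : ℝ} (ht : 0 < t) (hts : t < s)
    (a : discSpace p s) (n : ℕ) :
    ‖(a : ℕ → ℚ_[p]) n‖ * t ^ n ≤ supNorm p t a :=
  le_ciSup (discSpace_bddAbove ht hts a) n

/-- `supNorm p t` as a seminorm on the disc space of radius `s > t`. -/
noncomputable def discSeminorm (p : ℕ) [Fact p.Prime] {s t : ℝ} (ht : 0 < t) (hts : t < s) :
    Seminorm ℚ_[p] (discSpace p s) :=
  Seminorm.of (fun a => supNorm p t a)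
    (fun a b => ciSup_le fun n => by
      have hab : ‖((a + b : discSpace p s) : ℕ → ℚ_[p]) n‖ ≤
          ‖(a : ℕ → ℚ_[p]) n‖ + ‖(b : ℕ → ℚ_[p]) n‖ := norm_add_le _ _
      calc _ ≤ (‖(a : ℕ → ℚ_[p]) n‖ + ‖(b : ℕ → ℚ_[p]) n‖) * t ^ n := by gcongr
        _ = ‖(a : ℕ → ℚ_[p]) n‖ * t ^ n + ‖(b : ℕ → ℚ_[p]) n‖ * t ^ n := add_mul _ _ _
        _ ≤ _ := add_le_add (le_supNorm ht hts a n) (le_supNorm ht hts b n))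
    (fun c a => by
      simp only [supNorm, Submodule.coe_smul, Pi.smul_apply, norm_smul, mul_assoc]
      exact (Real.mul_iSup_of_nonneg (norm_nonneg c) _).symm)

theorem discSeminorm_apply {p : ℕ} [Fact p.Prime] {s t : ℝ} (ht : 0 < t) (hts : t < s)
    (a : discSpace p s) : discSeminorm p ht hts a = supNorm p t a := rfl

theorem supNorm_mono {p : ℕ} [Fact p.Prime] {s t t' : ℝ} (ht : 0 < t) (htt' : t ≤ t')
    (hts : t' < s) (a : discSpace p s) : supNorm p t a ≤ supNorm p t' a :=
  ciSup_mono (discSpace_bddAbove (ht.trans_le htt') hts a) fun n => by gcongr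

/-- The balls of the seminorms `supNorm p t` centred at a point form a neighbourhood basis. -/
theorem exists_supNorm_ball_subset {p : ℕ} [Fact p.Prime] {s : ℝ} (hs : 0 < s)
    {U : Set (discSpace p s)} (hU : @IsOpen _ (discTopology p s) U) :
    ∀ z ∈ U, ∃ t δ : ℝ, 0 < t ∧ t < s ∧ 0 < δ ∧
      ∀ x : discSpace p s, supNorm p t (x - z : discSpace p s) < δ → x ∈ U := by
  induction hU with
  | basic V hV =>
    obtain ⟨y, t, ε, ht, hts, -, rfl⟩ := hV
    intro z hz
    refine ⟨t, ε - supNorm p t (z - y : discSpace p s), ht, hts, sub_pos.2 hz, fun x hx => ?_⟩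
    have h := map_add_le_add (discSeminorm p ht hts) (x - z) (z - y)
    rw [sub_add_sub_cancel] at h
    exact h.trans_lt (lt_sub_iff_add_lt.1 hx)
  | univ => exact fun z _ => ⟨s / 2, 1, by linarith, by linarith, one_pos, fun _ _ => trivial⟩
  | inter V W _ _ ihV ihW =>
    rintro z ⟨hzV, hzW⟩
    obtain ⟨t₁, δ₁, ht₁, hts₁, hδ₁, h₁⟩ := ihV z hzV
    obtain ⟨t₂, δ₂, ht₂, hts₂, hδ₂, h₂⟩ := ihW z hzW
    refine ⟨max t₁ t₂, min δ₁ δ₂, lt_max_of_lt_left ht₁, max_lt hts₁ hts₂, lt_min hδ₁ hδ₂,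
      fun x hx => ⟨h₁ x ?_, h₂ x ?_⟩⟩
    · exact (supNorm_mono ht₁ (le_max_left _ _) (max_lt hts₁ hts₂) _).trans_lt
        (hx.trans_le (min_le_left _ _))
    · exact (supNorm_mono ht₂ (le_max_right _ _) (max_lt hts₁ hts₂) _).trans_lt
        (hx.trans_le (min_le_right _ _))
  | sUnion S _ ih =>
    rintro z ⟨V, hVS, hzV⟩
    obtain ⟨t, δ, ht, hts, hδ, h⟩ := ih V hVS z hzV
    exact ⟨t, δ, ht, hts, hδ, fun x hx => ⟨V, hVS, h x hx⟩⟩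

theorem eq_zero_of_supNorm_eq_zero {p : ℕ} [Fact p.Prime] {s t : ℝ} (ht : 0 < t) (hts : t < s)
    {a : discSpace p s} (ha : supNorm p t a = 0) : a = 0 := by
  ext n
  have h := le_supNorm ht hts a n
  rw [ha] at h
  simpa using nonpos_of_mul_nonpos_left h (pow_pos ht n)

theorem continuous_discTopology_iff {p : ℕ} [Fact p.Prime] {s : ℝ} (hs : 0 < s)
    (lam : discSpace p s →ₗ[ℚ_[p]] ℚ_[p]) :
    @Continuous _ _ (discTopology p s) _ (fun a => lam a) ↔
      ∃ t C : ℝ, 0 < t ∧ t < s ∧ 0 ≤ C ∧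
        ∀ a : discSpace p s, ‖lam a‖ ≤ C * supNorm p t (a : ℕ → ℚ_[p]) := by
  let _ := discTopology p s
  constructor
  · intro hlam
    obtain ⟨t, δ, ht, hts, hδ, h⟩ := exists_supNorm_ball_subset hs
      (Metric.isOpen_ball.preimage hlam : IsOpen ((fun a => lam a) ⁻¹' Metric.ball 0 1)) 0
      (by simp [Set.mem_preimage])
    obtain ⟨c, hc⟩ := NormedField.exists_one_lt_norm ℚ_[p]
    refine ⟨t, ‖c‖ / δ, ht, hts, by positivity, fun a => ?_⟩
    by_cases ha : supNorm p t a = 0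
    · rw [ha, eq_zero_of_supNorm_eq_zero ht hts ha, map_zero, norm_zero, mul_zero]
    refine Seminorm.bound_of_shell (discSeminorm p ht hts) ((normSeminorm ℚ_[p] ℚ_[p]).comp lam)
      hδ hc (fun x hx₁ hx₂ => ?_) ha
    have hx : ‖lam x‖ < 1 := by simpa using h x (by rwa [sub_zero])
    refine hx.le.trans ?_
    have hc₀ : 0 < ‖c‖ := one_pos.trans hc
    calc (1 : ℝ) = ‖c‖ / δ * (δ / ‖c‖) := by field_simp
      _ ≤ _ := by gcongr
  · rintro ⟨t, C, ht, hts, hC, h⟩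
    refine continuous_def.2 fun V hV => isOpen_iff_forall_mem_open.2 fun z hz => ?_
    obtain ⟨ε, hε, hεV⟩ := Metric.isOpen_iff.1 hV _ hz
    refine ⟨{x | supNorm p t ((x : ℕ → ℚ_[p]) - (z : ℕ → ℚ_[p])) < ε / (C + 1)}, fun x hx => ?_,
      TopologicalSpace.isOpen_generateFrom_of_mem ⟨z, t, _, ht, hts, by positivity, rfl⟩, ?_⟩
    · refine hεV ?_
      have hnn : 0 ≤ supNorm p t (x - z : discSpace p s) :=
        apply_nonneg (discSeminorm p ht hts) (x - z)
      have hx' : supNorm p t (x - z : discSpace p s) * (C + 1) < ε :=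
        (lt_div_iff₀ (by positivity)).1 hx
      rw [mem_ball_iff_norm, ← map_sub]
      have := h (x - z)
      linarith
    · have h₀ : supNorm p t ((z : ℕ → ℚ_[p]) - (z : ℕ → ℚ_[p])) = 0 := by
        simp [supNorm]
      rw [Set.mem_ofPred_eq, h₀]
      positivity

theorem supNorm_stdSeq_le {p : ℕ} [Fact p.Prime] {s t : ℝ} (ht : 0 < t) (n : ℕ) :
    supNorm p t (stdSeq p s n) ≤ t ^ n :=
  ciSup_le fun k => by
    by_cases hk : k = n
    · simp [stdSeq, hk]
    · simp [stdSeq, hk, ht.le]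

theorem exists_tendsto_apply_stdSeq {p : ℕ} [Fact p.Prime] {s t C : ℝ} (ht : 0 < t)
    (hts : t < s) (hC : 0 ≤ C) {lam : discSpace p s →ₗ[ℚ_[p]] ℚ_[p]}
    (h : ∀ a : discSpace p s, ‖lam a‖ ≤ C * supNorm p t (a : ℕ → ℚ_[p])) :
    ∃ u : ℝ, 1 / s < u ∧
      Tendsto (fun n : ℕ => ‖lam (stdSeq p s n)‖ * u ^ n) atTop (nhds 0) := by
  obtain ⟨u, hsu, hut⟩ := exists_between (one_div_lt_one_div_of_lt ht hts)
  have hu : 0 < u := (one_div_pos.2 (ht.trans hts)).trans hsu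
  have htu : t * u < 1 := by rwa [lt_div_iff₀' ht] at hut
  refine ⟨u, hsu, squeeze_zero (fun n => by positivity) (fun n => ?_)
    (by simpa using (tendsto_pow_atTop_nhds_zero_of_lt_one (by positivity) htu).const_mul C)⟩
  calc ‖lam (stdSeq p s n)‖ * u ^ n ≤ C * t ^ n * u ^ n := by
        gcongr
        exact (h _).trans (by gcongr; exact supNorm_stdSeq_le ht n)
    _ = C * (t * u) ^ n := by rw [mul_pow, mul_assoc]

theorem sum_smul_stdSeq_apply {p : ℕ} [Fact p.Prime] {s : ℝ} (a : ℕ → ℚ_[p]) (N k : ℕ) :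
    ((∑ n ∈ Finset.range N, a n • stdSeq p s n : discSpace p s) : ℕ → ℚ_[p]) k =
      if k < N then a k else 0 := by
  simp [stdSeq, Finset.sum_apply]

theorem tendsto_supNorm_sub_sum {p : ℕ} [Fact p.Prime] {s t : ℝ} (ht : 0 < t) (hts : t < s)
    (a : discSpace p s) :
    Tendsto (fun N : ℕ => supNorm p t
      (a - ∑ n ∈ Finset.range N, (a : ℕ → ℚ_[p]) n • stdSeq p s n : discSpace p s))
      atTop (nhds 0) := by
  rw [Metric.tendsto_atTop]
  intro ε hε
  obtain ⟨N₀, hN₀⟩ := Metric.tendsto_atTop.1 (a.2 t ht hts) (ε / 2) (half_pos hε)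
  refine ⟨N₀, fun N hN => ?_⟩
  rw [Real.dist_0_eq_abs, ← discSeminorm_apply ht hts, abs_of_nonneg (apply_nonneg _ _)]
  refine lt_of_le_of_lt (ciSup_le fun k => ?_) (half_lt_self hε)
  rw [Submodule.coe_sub, Pi.sub_apply, sum_smul_stdSeq_apply]
  split_ifs with hk
  · simpa using (half_pos hε).le
  · have := hN₀ k (hN.trans (not_lt.1 hk))
    rw [Real.dist_0_eq_abs] at this
    simpa using (le_abs_self _).trans this.le

theorem tendsto_sum_mul_apply_stdSeq {p : ℕ} [Fact p.Prime] {s t C : ℝ} (ht : 0 < t)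
    (hts : t < s) {lam : discSpace p s →ₗ[ℚ_[p]] ℚ_[p]}
    (h : ∀ a : discSpace p s, ‖lam a‖ ≤ C * supNorm p t (a : ℕ → ℚ_[p])) (a : discSpace p s) :
    Tendsto (fun N : ℕ => ∑ n ∈ Finset.range N, (a : ℕ → ℚ_[p]) n * lam (stdSeq p s n))
      atTop (nhds (lam a)) := by
  rw [tendsto_iff_norm_sub_tendsto_zero]
  refine squeeze_zero (fun _ => norm_nonneg _) (fun N => ?_)
    (by simpa only [mul_zero] using (tendsto_supNorm_sub_sum ht hts a).const_mul C)
  rw [norm_sub_rev]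
  have hN := h (a - ∑ n ∈ Finset.range N, (a : ℕ → ℚ_[p]) n • stdSeq p s n)
  simp only [map_sub, map_sum, map_smul, smul_eq_mul] at hN
  exact hN

theorem norm_mul_eq_weighted {p : ℕ} [Fact p.Prime] {u : ℝ} (hu : 0 < u) (x y : ℚ_[p]) (n : ℕ) :
    ‖x * y‖ = ‖x‖ * (1 / u) ^ n * (‖y‖ * u ^ n) := by
  rw [norm_mul, one_div, inv_pow]
  field_simp

theorem exists_apply_stdSeq_eq {p : ℕ} [Fact p.Prime] {s u : ℝ} (hs : 0 < s) (hu : 1 / s < u)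
    {b : ℕ → ℚ_[p]} (hb : Tendsto (fun n : ℕ => ‖b n‖ * u ^ n) atTop (nhds 0)) :
    ∃ lam : discSpace p s →ₗ[ℚ_[p]] ℚ_[p],
      @Continuous _ _ (discTopology p s) _ (fun a => lam a) ∧
        ∀ n : ℕ, lam (stdSeq p s n) = b n := by
  have hu₀ : 0 < u := (one_div_pos.2 hs).trans hu
  have ht : 0 < 1 / u := one_div_pos.2 hu₀
  have hts : 1 / u < s := (one_div_lt hs hu₀).1 hu
  have hsum (a : discSpace p s) : Summable fun n => (a : ℕ → ℚ_[p]) n * b n := by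
    refine NonarchimedeanAddGroup.summable_of_tendsto_cofinite_zero ?_
    rw [Nat.cofinite_eq_atTop, tendsto_zero_iff_norm_tendsto_zero]
    refine Tendsto.congr (fun n => (norm_mul_eq_weighted hu₀ _ (b n) n).symm) ?_
    simpa only [mul_zero] using (a.2 _ ht hts).mul hb
  let lam : discSpace p s →ₗ[ℚ_[p]] ℚ_[p] :=
    { toFun := fun a => ∑' n, (a : ℕ → ℚ_[p]) n * b n
      map_add' := fun a a' => by
        simp only [Submodule.coe_add, Pi.add_apply, add_mul]
        exact (hsum a).tsum_add (hsum a')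
      map_smul' := fun c a => by
        simp only [Submodule.coe_smul, Pi.smul_apply, smul_eq_mul, mul_assoc, RingHom.id_apply]
        exact tsum_mul_left }
  obtain ⟨B, hB⟩ := hb.bddAbove_range
  have hB' (n : ℕ) : ‖b n‖ * u ^ n ≤ B := hB ⟨n, rfl⟩
  have hB₀ : 0 ≤ B := (by positivity : 0 ≤ ‖b 0‖ * u ^ 0).trans (hB' 0)
  refine ⟨lam, (continuous_discTopology_iff hs lam).2 ⟨1 / u, B, ht, hts, hB₀, fun a => ?_⟩,
    fun n => ?_⟩
  · have ha₀ : 0 ≤ supNorm p (1 / u) a := apply_nonneg (discSeminorm p ht hts) a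
    refine IsUltrametricDist.norm_tsum_le_of_forall_le_of_nonneg (by positivity) fun n => ?_
    rw [norm_mul_eq_weighted hu₀ _ _ n, mul_comm B]
    exact mul_le_mul (le_supNorm ht hts a n) (hB' n) (by positivity) ha₀
  · change ∑' k, (if k = n then (1 : ℚ_[p]) else 0) * b k = b n
    simp

/-- The continuous dual of the Fréchet space of rigid analytic functions on the open disc
of radius `s` over `ℚ_p`: (1) a `ℚ_p`-linear functional `λ` is continuous iff it is bounded
by `C·‖·‖_t` for some `0 < t < s` and `C ≥ 0`; (2) `λ ↦ (λ(eₙ))ₙ` is a `ℚ_p`-linear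
bijection from the continuous dual onto the sequences `b` with `‖bₙ‖ uⁿ → 0` for some
`u > 1/s`, and `∑ₙ aₙ·λ(eₙ)` converges to `λ(a)` for every `a`. -/
theorem statement8 (p : ℕ) [Fact p.Prime] (s : ℝ) (hs : 0 < s) :
    -- (1)
    (∀ lam : ↥(discSpace p s) →ₗ[ℚ_[p]] ℚ_[p],
      @Continuous _ _ (discTopology p s) _ (fun a => lam a) ↔
        ∃ t C : ℝ, 0 < t ∧ t < s ∧ 0 ≤ C ∧
          ∀ a : ↥(discSpace p s), ‖lam a‖ ≤ C * supNorm p t (a : ℕ → ℚ_[p])) ∧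
    -- (2): the dual sequence has the right decay
    (∀ lam : ↥(discSpace p s) →ₗ[ℚ_[p]] ℚ_[p],
      @Continuous _ _ (discTopology p s) _ (fun a => lam a) →
        ∃ u : ℝ, 1 / s < u ∧
          Tendsto (fun n : ℕ => ‖lam (stdSeq p s n)‖ * u ^ n) atTop (nhds 0)) ∧
    -- (2): injectivity
    (∀ lam₁ lam₂ : ↥(discSpace p s) →ₗ[ℚ_[p]] ℚ_[p],
      @Continuous _ _ (discTopology p s) _ (fun a => lam₁ a) →
      @Continuous _ _ (discTopology p s) _ (fun a => lam₂ a) →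
      (∀ n : ℕ, lam₁ (stdSeq p s n) = lam₂ (stdSeq p s n)) → lam₁ = lam₂) ∧
    -- (2): surjectivity
    (∀ b : ℕ → ℚ_[p],
      (∃ u : ℝ, 1 / s < u ∧ Tendsto (fun n : ℕ => ‖b n‖ * u ^ n) atTop (nhds 0)) →
      ∃ lam : ↥(discSpace p s) →ₗ[ℚ_[p]] ℚ_[p],
        @Continuous _ _ (discTopology p s) _ (fun a => lam a) ∧
          ∀ n : ℕ, lam (stdSeq p s n) = b n) ∧
    -- (2): the series `∑ aₙ bₙ` converges to `λ a`
    (∀ lam : ↥(discSpace p s) →ₗ[ℚ_[p]] ℚ_[p],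
      @Continuous _ _ (discTopology p s) _ (fun a => lam a) →
      ∀ a : ↥(discSpace p s),
        Tendsto
          (fun N : ℕ => ∑ n ∈ Finset.range N, (a : ℕ → ℚ_[p]) n * lam (stdSeq p s n))
          atTop (nhds (lam a))) := by
  refine ⟨continuous_discTopology_iff hs, fun lam hlam => ?_, fun lam₁ lam₂ h₁ h₂ h => ?_,
    fun b ⟨u, hu, hb⟩ => exists_apply_stdSeq_eq hs hu hb, fun lam hlam a => ?_⟩
  · obtain ⟨t, C, ht, hts, hC, hbound⟩ := (continuous_discTopology_iff hs lam).1 hlam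
    exact exists_tendsto_apply_stdSeq ht hts hC hbound
  · obtain ⟨t₁, C₁, ht₁, hts₁, -, hbound₁⟩ := (continuous_discTopology_iff hs lam₁).1 h₁
    obtain ⟨t₂, C₂, ht₂, hts₂, -, hbound₂⟩ := (continuous_discTopology_iff hs lam₂).1 h₂
    refine LinearMap.ext fun a => tendsto_nhds_unique
      (tendsto_sum_mul_apply_stdSeq ht₁ hts₁ hbound₁ a) ?_
    simp_rw [h]
    exact tendsto_sum_mul_apply_stdSeq ht₂ hts₂ hbound₂ a
  · obtain ⟨t, C, ht, hts, -, hbound⟩ := (continuous_discTopology_iff hs lam).1 hlam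
    exact tendsto_sum_mul_apply_stdSeq ht hts hbound a
end
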